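/- Let X be a topological space satisfying Menger's property S_fin(O,O). Then Alice does not have a winning strategy in the game G_fin(Λ,Λ) played on X, in which Alice plays large open covers, Bob selects finite subsets, and Bob wins if the union of his selections is a large cover of X. -/

import Mathlib

/-- `𝒰` is an open cover of the space `X`. -/
def IsOpenCover {X : Type*} [TopologicalSpace X] (𝒰 : Set (Set X)) : Prop :=
  (∀ U ∈ 𝒰, IsOpen U) ∧ ⋃₀ 𝒰 = Set.univ

/-- Menger's property `S_fin(O,O)`. -/
def MengerSpace (X : Type*) [TopologicalSpace X] : Prop :=
  ∀ 𝒰 : ℕ → Set (Set X), (∀ n, IsOpenCover (𝒰 n)) →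
    ∃ ℱ : ℕ → Set (Set X), (∀ n, (ℱ n).Finite ∧ ℱ n ⊆ 𝒰 n) ∧
      ⋃₀ (⋃ n, ℱ n) = Set.univ

/-- A family `𝒰` is a *large cover* of `X` if every point of `X` belongs to infinitely many
members of `𝒰`. -/
def IsLargeCover {X : Type*} [TopologicalSpace X] (𝒰 : Set (Set X)) : Prop :=
  ∀ x : X, {U ∈ 𝒰 | x ∈ U}.Infinite

/-- A large cover all of whose members are open. -/
def IsLargeOpenCover {X : Type*} [TopologicalSpace X] (𝒰 : Set (Set X)) : Prop :=
  (∀ U ∈ 𝒰, IsOpen U) ∧ IsLargeCover 𝒰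

/-- A strategy for Alice in the game `G_fin(Λ,Λ)` is winning if for every play of Bob
consisting of legal moves (finite subsets of Alice's large open covers), the union of Bob's
selections fails to be a large cover of the space. -/
def LargeWinningStrategy {X : Type*} [TopologicalSpace X]
    (strat : List (Set (Set X)) → Set (Set X)) : Prop :=
  ∀ F : ℕ → Set (Set X),
    (∀ n, (F n).Finite ∧ F n ⊆ strat (List.ofFn fun i : Fin n => F i)) →
    ¬ IsLargeCover (⋃ n, F n)

/-- The product of a Menger space with the discrete space `ℕ` is Menger. -/
theorem MengerSpace.prod_nat {X : Type*} [TopologicalSpace X] (hX : MengerSpace X) :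
    MengerSpace (X × ℕ) := by
  intro 𝒰 h𝒰
  have slice (j : ℕ) : ∃ ℱ : ℕ → Set (Set (X × ℕ)),
      (∀ i, (ℱ i).Finite ∧ ℱ i ⊆ 𝒰 (Nat.pair j i)) ∧
        ∀ x, ∃ i, ∃ U ∈ ℱ i, (x, j) ∈ U := by
    obtain ⟨𝒮, h𝒮, hcov⟩ := hX
      (fun i => (fun U : Set (X × ℕ) => (fun x => (x, j)) ⁻¹' U) '' 𝒰 (Nat.pair j i)) (by
        intro i
        refine ⟨?_, Set.eq_univ_of_forall fun x => ?_⟩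
        · rintro _ ⟨U, hU, rfl⟩
          exact ((h𝒰 _).1 U hU).preimage (by fun_prop)
        · obtain ⟨U, hU, hxU⟩ : (x, j) ∈ ⋃₀ 𝒰 (Nat.pair j i) := by
            rw [(h𝒰 _).2]; trivial
          exact ⟨_, ⟨U, hU, rfl⟩, hxU⟩)
    have lift (i : ℕ) := Set.exists_subset_image_finite_and (p := fun t => 𝒮 i = t) |>.1
      ⟨𝒮 i, (h𝒮 i).2, (h𝒮 i).1, rfl⟩
    choose ℱ hsub hfin himage using lift
    refine ⟨ℱ, fun i => ⟨hfin i, hsub i⟩, fun x => ?_⟩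
    obtain ⟨S, hS, hxS⟩ : x ∈ ⋃₀ ⋃ i, 𝒮 i := by rw [hcov]; trivial
    obtain ⟨i, hi⟩ := Set.mem_iUnion.1 hS
    rw [himage i] at hi
    obtain ⟨U, hU, rfl⟩ := hi
    exact ⟨i, U, hU, hxS⟩
  choose ℱ hℱ hcov using slice
  refine ⟨fun n => ℱ n.unpair.1 n.unpair.2, fun n => ?_, Set.eq_univ_of_forall ?_⟩
  · simpa using hℱ n.unpair.1 n.unpair.2
  · rintro ⟨x, j⟩
    obtain ⟨i, U, hU, hxU⟩ := hcov j x
    exact ⟨U, Set.mem_iUnion.2 ⟨Nat.pair j i, by simpa using hU⟩, hxU⟩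

/-- For a sequence of countable open covers of a Menger space, finite initial segments can be
chosen which together cover the space. -/
theorem MengerSpace.exists_bound {Y : Type*} [TopologicalSpace Y] (hY : MengerSpace Y)
    (V : ℕ → ℕ → Set Y) (hopen : ∀ n k, IsOpen (V n k)) (hcov : ∀ n y, ∃ k, y ∈ V n k) :
    ∃ f : ℕ → ℕ, ∀ y, ∃ n, ∃ k ≤ f n, y ∈ V n k := by
  obtain ⟨ℱ, hℱ, hun⟩ := hY (fun n => Set.range (V n)) fun n =>
    ⟨by rintro _ ⟨k, rfl⟩; exact hopen n k,
      Set.eq_univ_of_forall fun y => (hcov n y).elim fun k hk => ⟨_, ⟨k, rfl⟩, hk⟩⟩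
  have bound (n : ℕ) : ∃ b, ∀ U ∈ ℱ n, ∃ k ≤ b, V n k = U := by
    choose! k hk using fun U (hU : U ∈ ℱ n) => (hℱ n).2 hU
    obtain ⟨b, hb⟩ := ((hℱ n).1.image k).bddAbove
    exact ⟨b, fun U hU => ⟨k U, hb ⟨U, hU, rfl⟩, hk U hU⟩⟩
  choose f hf using bound
  refine ⟨f, fun y => ?_⟩
  obtain ⟨U, hU, hyU⟩ : y ∈ ⋃₀ ⋃ n, ℱ n := by rw [hun]; trivial
  obtain ⟨n, hn⟩ := Set.mem_iUnion.1 hU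
  obtain ⟨k, hk, rfl⟩ := hf n U hn
  exact ⟨n, k, hk, hyU⟩

/-- Every open cover of a Menger space contains an increasing sequence of finite families whose
union covers the space. -/
theorem MengerSpace.exists_monotone_finite {X : Type*} [TopologicalSpace X] (hX : MengerSpace X)
    {𝒰 : Set (Set X)} (h𝒰 : IsOpenCover 𝒰) :
    ∃ 𝒢 : ℕ → Set (Set X), Monotone 𝒢 ∧ (∀ m, (𝒢 m).Finite) ∧ (∀ m, 𝒢 m ⊆ 𝒰) ∧
      ∀ x, ∃ m, x ∈ ⋃₀ 𝒢 m := by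
  obtain ⟨ℱ, hℱ, hun⟩ := hX (fun _ => 𝒰) fun _ => h𝒰
  refine ⟨Set.accumulate ℱ, Set.monotone_accumulate, fun m => ?_, fun m => ?_, fun x => ?_⟩
  · exact (Set.finite_Iic m).biUnion fun i _ => (hℱ i).1
  · exact Set.iUnion₂_subset fun i _ => (hℱ i).2
  · obtain ⟨U, hU, hxU⟩ : x ∈ ⋃₀ ⋃ n, ℱ n := by rw [hun]; trivial
    obtain ⟨n, hn⟩ := Set.mem_iUnion.1 hU
    exact ⟨n, U, Set.subset_accumulate hn, hxU⟩

/-- The part of the space covered along the finite branch `s`, whose entries are listed from the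
last move to the first, when the move `m` at position `s` covers `D s m`. -/
def branchUnion {Y : Type*} (D : List ℕ → ℕ → Set Y) : List ℕ → Set Y
  | [] => ∅
  | m :: s => branchUnion D s ∪ D s m

/-- If every `D s` is increasing, this is the set of points covered along all extensions of `s` by
`n` moves at least one of which is `≥ k`. -/
def tailInter {Y : Type*} (D : List ℕ → ℕ → Set Y) (k : ℕ) : ℕ → List ℕ → Set Y
  | 0, _ => Set.univ
  | n + 1, s => branchUnion D (k :: s) ∩ ⋂ m ∈ Set.Iio k, tailInter D k n (m :: s)

/-- The finite branch consisting of the first `n` values of `f`, the last value first. -/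
def branch (f : ℕ → ℕ) : ℕ → List ℕ
  | 0 => []
  | n + 1 => f n :: branch f n

section Tree

variable {Y : Type*} {D : List ℕ → ℕ → Set Y}

theorem isOpen_branchUnion [TopologicalSpace Y] (hopen : ∀ s m, IsOpen (D s m)) (s : List ℕ) :
    IsOpen (branchUnion D s) := by
  induction s with
  | nil => exact isOpen_empty
  | cons m s ih => exact ih.union (hopen s m)

theorem isOpen_tailInter [TopologicalSpace Y] (hopen : ∀ s m, IsOpen (D s m)) (k n : ℕ)
    (s : List ℕ) : IsOpen (tailInter D k n s) := by
  induction n generalizing s with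
  | zero => exact isOpen_univ
  | succ n ih =>
    exact (isOpen_branchUnion hopen _).inter
      ((Set.finite_Iio k).isOpen_biInter fun m _ => ih (m :: s))

theorem branchUnion_subset_tailInter (k n : ℕ) (s : List ℕ) :
    branchUnion D s ⊆ tailInter D k n s := by
  induction n generalizing s with
  | zero => exact Set.subset_univ _
  | succ n ih =>
    exact Set.subset_inter Set.subset_union_left
      (Set.subset_iInter₂ fun m _ => Set.subset_union_left.trans (ih (m :: s)))

theorem eventually_mem_tailInter (hmono : ∀ s, Monotone (D s)) (hcov : ∀ s y, ∃ m, y ∈ D s m)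
    (n : ℕ) (s : List ℕ) (y : Y) : ∀ᶠ k in Filter.atTop, y ∈ tailInter D k n s := by
  induction n generalizing s with
  | zero => exact Filter.Eventually.of_forall fun _ => trivial
  | succ n ih =>
    obtain ⟨m₀, hm₀⟩ := hcov s y
    have large (m : ℕ) (hm : m₀ ≤ m) : y ∈ branchUnion D (m :: s) := Or.inr (hmono s hm hm₀)
    filter_upwards [Filter.eventually_ge_atTop m₀,
      (Filter.eventually_all_finite (Set.finite_Iio m₀)).2 fun m _ => ih (m :: s)] with k hk hsmall
    refine ⟨large k hk, Set.mem_iInter₂.2 fun m _ => ?_⟩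
    rcases lt_or_ge m m₀ with hm | hm
    · exact hsmall m hm
    · exact branchUnion_subset_tailInter _ _ _ (large m hm)

theorem exists_mem_of_mem_branchUnion {f : ℕ → ℕ} {y : Y} {n : ℕ}
    (hy : y ∈ branchUnion D (branch f n)) : ∃ i, y ∈ D (branch f i) (f i) := by
  induction n with
  | zero => exact hy.elim
  | succ n ih => exact hy.elim ih fun h => ⟨n, h⟩

theorem exists_mem_of_mem_tailInter (hmono : ∀ s, Monotone (D s)) {f : ℕ → ℕ} {y : Y} {k n i : ℕ}
    (hk : k ≤ f (i + n)) (hy : y ∈ tailInter D k (n + 1) (branch f i)) :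
    ∃ j, y ∈ D (branch f j) (f j) := by
  induction n generalizing i with
  | zero => exact hy.1.elim exists_mem_of_mem_branchUnion fun h => ⟨i, hmono _ hk h⟩
  | succ n ih =>
    rcases le_or_gt k (f i) with hi | hi
    · exact hy.1.elim exists_mem_of_mem_branchUnion fun h => ⟨i, hmono _ hi h⟩
    · refine ih (i := i + 1) (by rwa [add_right_comm, add_assoc]) ?_
      exact Set.mem_iInter₂.1 hy.2 (f i) hi

/-- Hurewicz's theorem for trees of increasing countable open covers: some branch of the tree
covers a Menger space. -/
theorem MengerSpace.exists_branch [TopologicalSpace Y] (hY : MengerSpace Y)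
    (hopen : ∀ s m, IsOpen (D s m)) (hmono : ∀ s, Monotone (D s))
    (hcov : ∀ s y, ∃ m, y ∈ D s m) :
    ∃ f : ℕ → ℕ, ∀ y, ∃ n, y ∈ D (branch f n) (f n) := by
  obtain ⟨f, hf⟩ := hY.exists_bound (fun n k => tailInter D k (n + 1) [])
    (fun n k => isOpen_tailInter hopen k (n + 1) [])
    (fun n y => (eventually_mem_tailInter hmono hcov (n + 1) [] y).exists)
  refine ⟨f, fun y => ?_⟩
  obtain ⟨n, k, hk, hy⟩ := hf y
  exact exists_mem_of_mem_tailInter (i := 0) hmono (by rwa [zero_add]) hy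

end Tree

/-- A large open cover remains an open cover after removing finitely many members. -/
theorem IsLargeOpenCover.isOpenCover_diff {X : Type*} [TopologicalSpace X] {𝒰 𝒱 : Set (Set X)}
    (h𝒰 : IsLargeOpenCover 𝒰) (h𝒱 : 𝒱.Finite) : IsOpenCover (𝒰 \ 𝒱) := by
  refine ⟨fun U hU => h𝒰.1 U hU.1, Set.eq_univ_of_forall fun x => ?_⟩
  obtain ⟨U, ⟨hU, hxU⟩, hUV⟩ := ((h𝒰.2 x).sdiff h𝒱).nonempty
  exact ⟨U, ⟨hU, hUV⟩, hxU⟩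

/-- Pairwise disjoint families, infinitely many of which cover any given point, form a large
cover. -/
theorem isLargeCover_iUnion {X : Type*} [TopologicalSpace X] {F : ℕ → Set (Set X)}
    (hdisj : Pairwise (Function.onFun Disjoint F)) (hF : ∀ x, {n | x ∈ ⋃₀ F n}.Infinite) :
    IsLargeCover (⋃ n, F n) := by
  intro x
  choose! u hu using fun n (hn : n ∈ {n | x ∈ ⋃₀ F n}) => hn
  refine Set.infinite_of_injOn_mapsTo (f := u) (fun m hm n hn hmn => ?_)
    (fun n hn => ⟨Set.mem_iUnion.2 ⟨n, (hu n hn).1⟩, (hu n hn).2⟩) (hF x)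
  by_contra hne
  exact Set.disjoint_left.1 (hdisj hne) (hu m hm).1 (hmn ▸ (hu n hn).1)

/-- The history of the game in which Bob's move after the history `h` is `G h m`, where `m` is
the corresponding entry of the given list; the entries are listed from the last to the first. -/
def gameHistory {α : Type*} (G : List α → ℕ → α) : List ℕ → List α
  | [] => []
  | m :: s => gameHistory G s ++ [G (gameHistory G s) m]

theorem ofFn_eq_gameHistory {α : Type*} (G : List α → ℕ → α) (f : ℕ → ℕ) (n : ℕ) :
    List.ofFn (fun i : Fin n => G (gameHistory G (branch f i)) (f i)) =
      gameHistory G (branch f n) := by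
  induction n with
  | zero => rfl
  | succ n ih =>
    rw [List.ofFn_succ_last]
    simp only [Fin.val_castSucc, Fin.val_last, ih]
    rfl

/-- If `X` satisfies Menger's property `S_fin(O,O)`, then Alice has no winning strategy in
the game `G_fin(Λ,Λ)` on `X`. -/
theorem no_winning_strategy_large_game {X : Type*} [TopologicalSpace X]
    (hX : MengerSpace X) :
    ¬ ∃ strat : List (Set (Set X)) → Set (Set X),
      (∀ hist, IsLargeOpenCover (strat hist)) ∧ LargeWinningStrategy strat := by
  rintro ⟨strat, hlarge, hwin⟩
  choose! G hGmono hGfin hGsub hGcov using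
    fun (h : List (Set (Set X))) (hh : ∀ F ∈ h, F.Finite) =>
      hX.exists_monotone_finite
        ((hlarge h).isOpenCover_diff (h.finite_toSet.biUnion (t := id) hh))
  have hist_finite (s : List ℕ) : ∀ F ∈ gameHistory G s, F.Finite := by
    induction s with
    | nil => simp [gameHistory]
    | cons m s ih =>
      intro F hF
      rcases List.mem_append.1 hF with hF | hF
      · exact ih F hF
      · rw [List.mem_singleton.1 hF]
        exact hGfin _ ih m
  obtain ⟨f, hf⟩ := hX.prod_nat.exists_branch
    (D := fun s m => (⋃₀ G (gameHistory G s) m) ×ˢ Set.Iic m)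
    (fun s m => (isOpen_sUnion fun U hU =>
      (hlarge _).1 U (hGsub _ (hist_finite s) m hU).1).prod (isOpen_discrete _))
    (fun s m n hmn => Set.prod_mono
      (Set.sUnion_subset_sUnion (hGmono _ (hist_finite s) hmn)) (Set.Iic_subset_Iic.2 hmn))
    (by
      rintro s ⟨x, k⟩
      obtain ⟨m, hm⟩ := hGcov _ (hist_finite s) x
      exact ⟨max m k, Set.sUnion_subset_sUnion
        (hGmono _ (hist_finite s) (le_max_left m k)) hm, le_max_right m k⟩)
  set F : ℕ → Set (Set X) := fun n => G (gameHistory G (branch f n)) (f n)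
  have ofFn_eq (n : ℕ) : List.ofFn (fun i : Fin n => F i) = gameHistory G (branch f n) :=
    ofFn_eq_gameHistory G f n
  have hlegal (n : ℕ) := hGsub _ (hist_finite (branch f n)) (f n)
  refine hwin F (fun n => ⟨hGfin _ (hist_finite _) _, ?_⟩) (isLargeCover_iUnion ?_ fun x => ?_)
  · rw [ofFn_eq]
    exact (hlegal n).trans Set.sdiff_subset
  · refine (pairwise_disjoint_on F).2 fun m n hmn => Set.disjoint_left.2 fun U hUm hUn => ?_
    refine (hlegal n hUn).2 (Set.mem_biUnion (x := F m) ?_ hUm)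
    rw [← ofFn_eq]
    exact (List.mem_ofFn' _ _).2 ⟨⟨m, hmn⟩, rfl⟩
  · intro hfin
    obtain ⟨b, hb⟩ := (hfin.image f).bddAbove
    obtain ⟨n, hxn, hbn⟩ := hf (x, b + 1)
    exact absurd (hb ⟨n, hxn, rfl⟩) (not_le.2 hbn)
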